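/- There do not exist differentiable functions m, γ : [0,∞) → ℝ satisfying m'(t) = −(1/2)·γ(t)² − (1/2)·m(t)² and γ'(t) = −γ(t)·m(t) for all t ≥ 0, with m(0) ≤ 0 and γ(0) ≠ 0. -/

import Mathlib

open Real Set

/-- The Riccati equation `a' = -a² / 2` has no solution on `[0, ∞)` with `a 0 < 0`. -/
theorem riccati_no_global_solution {a : ℝ → ℝ}
    (ha : ∀ t ∈ Ici (0 : ℝ), HasDerivWithinAt a (-(1 / 2) * (a t) ^ 2) (Ici (0 : ℝ)) t) :
    0 ≤ a 0 := by
  by_contra! h0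
  have hanti : AntitoneOn a (Ici 0) := by
    refine antitoneOn_of_hasDerivWithinAt_nonpos (f' := fun t => -(1 / 2) * (a t) ^ 2)
      (convex_Ici 0) (fun t ht => (ha t ht).continuousWithinAt)
      (fun t ht => (ha t (interior_subset ht)).mono interior_subset) fun t _ => ?_
    nlinarith [sq_nonneg (a t)]
  have hneg : ∀ t ∈ Ici (0 : ℝ), a t < 0 := fun t ht =>
    (hanti self_mem_Ici ht ht).trans_lt h0
  have hderiv : ∀ t ∈ Ici (0 : ℝ),
      HasDerivWithinAt (fun s => (a s)⁻¹ - s / 2) 0 (Ici (0 : ℝ)) t := fun t ht => by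
    have hne := (hneg t ht).ne
    refine (((ha t ht).fun_inv hne).sub ((hasDerivWithinAt_id t _).div_const 2)).congr_deriv ?_
    field_simp
    norm_num
  have hT : 0 ≤ -2 * (a 0)⁻¹ := by
    nlinarith [inv_lt_zero.2 h0]
  have hconst := constant_of_has_deriv_right_zero
    (fun t ht => ((hderiv t ht.1).continuousWithinAt).mono Icc_subset_Ici_self)
    (fun t ht => (hderiv t ht.1).mono (Ici_subset_Ici.2 ht.1)) _ (right_mem_Icc.2 hT)
  have hinv := inv_lt_zero.2 (hneg _ hT)
  linarith

theorem ode_system_no_global_solution_a_zero :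
    ¬ ∃ m γ : ℝ → ℝ,
      (∀ t ∈ Set.Ici (0:ℝ),
        HasDerivWithinAt m (-(1 / 2) * (γ t) ^ 2 - (1 / 2) * (m t) ^ 2) (Set.Ici (0:ℝ)) t) ∧
      (∀ t ∈ Set.Ici (0:ℝ),
        HasDerivWithinAt γ (-(γ t * m t)) (Set.Ici (0:ℝ)) t) ∧
      m 0 ≤ 0 ∧ γ 0 ≠ 0 := by
  rintro ⟨m, γ, hm, hγ, hm0, hγ0⟩
  have hadd : 0 ≤ m 0 + γ 0 := riccati_no_global_solution (a := fun t => m t + γ t)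
    fun t ht => ((hm t ht).add (hγ t ht)).congr_deriv (by ring)
  have hsub : 0 ≤ m 0 - γ 0 := riccati_no_global_solution (a := fun t => m t - γ t)
    fun t ht => ((hm t ht).sub (hγ t ht)).congr_deriv (by ring)
  exact hγ0 (by linarith)
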